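/- Let n ∈ ℕ, λ = 1 + 1/(n+1), and Δ̃ f = ((λ-1)/(2 sinθ)) d/dθ(sinθ df/dθ) - λ cotθ df/dθ + ((1+cos²θ)/sin²θ) f. Then for every m ≥ 1, Δ̃(cosθ sin^{2m}θ) = (cosθ/(n+1)) · [ m(2n-2m+1) sin^{2m}θ + 2(m-1)(m-n-1) sin^{2m-2}θ ]. -/

import Mathlib

open Real Set

theorem stmt_10 (n m : ℕ) (hm : 1 ≤ m) (lam : ℝ) (hlam : lam = 1 + 1 / ((n : ℝ) + 1)) :
    ∀ θ ∈ Set.Ioo 0 Real.pi,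
      ((lam - 1) / (2 * Real.sin θ)) *
          deriv (fun x => Real.sin x *
            deriv (fun y => Real.cos y * Real.sin y ^ (2 * m)) x) θ -
        lam * (Real.cos θ / Real.sin θ) *
          deriv (fun y => Real.cos y * Real.sin y ^ (2 * m)) θ +
        ((1 + Real.cos θ ^ 2) / Real.sin θ ^ 2) * (Real.cos θ * Real.sin θ ^ (2 * m)) =
      (Real.cos θ / ((n : ℝ) + 1)) *
        ((m : ℝ) * (2 * (n : ℝ) - 2 * (m : ℝ) + 1) * Real.sin θ ^ (2 * m) +
          2 * ((m : ℝ) - 1) * ((m : ℝ) - (n : ℝ) - 1) * Real.sin θ ^ (2 * m - 2)) := by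
  intro θ hθ
  have hs : Real.sin θ ≠ 0 := (Real.sin_pos_of_pos_of_lt_pi hθ.1 hθ.2).ne'
  have hn : (n : ℝ) + 1 ≠ 0 := by positivity
  obtain ⟨p, rfl⟩ : ∃ p, m = p + 1 := ⟨m - 1, by omega⟩
  have e1 : 2 * (p + 1) - 2 = 2 * p := by omega
  have h1 : ∀ x : ℝ, deriv (fun y => Real.cos y * Real.sin y ^ (2 * (p + 1))) x =
      (2 * (p : ℝ) + 2) * Real.sin x ^ (2 * p + 1)
        - (2 * (p : ℝ) + 3) * Real.sin x ^ (2 * p + 3) := by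
    intro x
    have h := (Real.hasDerivAt_cos x).mul ((Real.hasDerivAt_sin x).pow (2 * (p + 1)))
    refine h.deriv.trans ?_
    have e2 : 2 * (p + 1) - 1 = 2 * p + 1 := by omega
    simp only [e2, Pi.pow_apply]
    push_cast
    have hc := Real.cos_sq' x
    linear_combination (2 * (p : ℝ) + 2) * Real.sin x ^ (2 * p + 1) * hc
  have h2 : deriv (fun x => Real.sin x * ((2 * (p : ℝ) + 2) * Real.sin x ^ (2 * p + 1)
        - (2 * (p : ℝ) + 3) * Real.sin x ^ (2 * p + 3))) θ =
      Real.cos θ * ((2 * (p : ℝ) + 2) ^ 2 * Real.sin θ ^ (2 * p + 1)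
        - (2 * (p : ℝ) + 3) * (2 * (p : ℝ) + 4) * Real.sin θ ^ (2 * p + 3)) := by
    have d := Real.hasDerivAt_sin θ
    have h := d.mul (((d.pow (2 * p + 1)).const_mul (2 * (p : ℝ) + 2)).sub
      ((d.pow (2 * p + 3)).const_mul (2 * (p : ℝ) + 3)))
    refine h.deriv.trans ?_
    have e2 : 2 * p + 1 - 1 = 2 * p := by omega
    have e3 : 2 * p + 3 - 1 = 2 * p + 2 := by omega
    simp only [e2, e3, Pi.pow_apply, Pi.sub_apply]
    push_cast
    ring
  simp only [h1]
  rw [h2, e1, hlam, Real.cos_sq']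
  push_cast
  have e4 : Real.sin θ ^ (2 * (p + 1)) = Real.sin θ ^ (2 * p) * Real.sin θ ^ 2 := by ring
  have e5 : Real.sin θ ^ (2 * p + 1) = Real.sin θ ^ (2 * p) * Real.sin θ := by ring
  have e6 : Real.sin θ ^ (2 * p + 3) = Real.sin θ ^ (2 * p) * Real.sin θ ^ 3 := by ring
  rw [e4, e5, e6]
  generalize Real.sin θ ^ (2 * p) = S
  field_simp
  ring
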